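/- arXiv:math/0610347 — 5 statements merged into one kernel-verified Lean document; each statement's English description precedes it below -/
import Mathlib

section
/- Let L be a finite-dimensional n-Lie algebra, let E = E_L(d) be an Engel subalgebra of L, and let U be a subalgebra of L with E ⊆ U. Then N_L(U) = U. -/
namespace NLie

open Finset

variable {F : Type*} [Field F] {L : Type*} [AddCommGroup L] [Module F L] {n : ℕ}

/-- The generalized Jacobi identity for an `(n+2)`-ary alternating bracket:
`[y₁,…,y_{n+1},[x₁,…,x_{n+2}]] = ∑ᵢ [x₁,…,[y₁,…,y_{n+1},xᵢ],…,x_{n+2}]`.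
(This is the identity (1) of the paper, rewritten with the string `y` in the
first `n+1` slots, which is equivalent since the bracket is alternating.) -/
def IsNLie (f : AlternatingMap F L L (Fin (n + 2))) : Prop :=
  ∀ (y : Fin (n + 1) → L) (x : Fin (n + 2) → L),
    f (Fin.snoc y (f x)) = ∑ i, f (Function.update x i (f (Fin.snoc y (x i))))

/-- `d : L → L` is a derivation of the bracket `f`. -/
def IsDerivation (f : AlternatingMap F L L (Fin (n + 2))) (d : L →ₗ[F] L) : Prop :=
  ∀ x : Fin (n + 2) → L, d (f x) = ∑ i, f (Function.update x i (d (x i)))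

/-- The (inner) derivation `D(a₁,…,a_{n+1}) : x ↦ [a₁,…,a_{n+1},x]`. -/
def D (f : AlternatingMap F L L (Fin (n + 2))) (a : Fin (n + 1) → L) : L →ₗ[F] L where
  toFun x := f (Fin.snoc a x)
  map_add' x y := by
    have h := f.toMultilinearMap.map_update_add (Fin.snoc a x) (Fin.last (n + 1)) x y
    simpa [Fin.update_snoc_last] using h
  map_smul' c x := by
    have h := f.toMultilinearMap.map_update_smul (Fin.snoc a x) (Fin.last (n + 1)) c x
    simpa [Fin.update_snoc_last] using h

/-- `D(U)`: the span of all inner derivations `D(a₁,…,a_{n+1})` with all `aᵢ ∈ U`. -/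
def Dspan (f : AlternatingMap F L L (Fin (n + 2))) (U : Submodule F L) :
    Submodule F (L →ₗ[F] L) :=
  Submodule.span F {d | ∃ a : Fin (n + 1) → L, (∀ i, a i ∈ U) ∧ d = D f a}

/-- The Engel subspace `E_L(d) = {x ∈ L ∣ dʳ x = 0 for some r}`. -/
def engel (d : L →ₗ[F] L) : Submodule F L where
  carrier := {x | ∃ r, (d ^ r) x = 0}
  zero_mem' := ⟨0, map_zero _⟩
  add_mem' := by
    rintro a b ⟨r, hr⟩ ⟨s, hs⟩
    refine ⟨r + s, ?_⟩
    have h1 : (d ^ (r + s)) a = (d ^ s) ((d ^ r) a) := by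
      rw [add_comm r s, pow_add]; rfl
    have h2 : (d ^ (r + s)) b = (d ^ r) ((d ^ s) b) := by
      rw [pow_add]; rfl
    rw [map_add, h1, h2, hr, hs, map_zero, map_zero, add_zero]
  smul_mem' := by
    rintro c a ⟨r, hr⟩
    exact ⟨r, by rw [map_smul, hr, smul_zero]⟩

/-- `E` is an Engel subalgebra of `L`: `E = E_L(d)` for some inner derivation `d ∈ D(E)`. -/
def IsEngel (f : AlternatingMap F L L (Fin (n + 2))) (E : Submodule F L) : Prop :=
  ∃ d : L →ₗ[F] L, d ∈ Dspan f E ∧ E = engel d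

/-- `[A₁,…,A_{n+2}]`: the subspace spanned by all brackets with `aᵢ ∈ Aᵢ`. -/
def bracketSpan (f : AlternatingMap F L L (Fin (n + 2))) (A : Fin (n + 2) → Submodule F L) :
    Submodule F L :=
  Submodule.span F {z | ∃ a : Fin (n + 2) → L, (∀ i, a i ∈ A i) ∧ f a = z}

/-- `K` is a subalgebra of `L`. -/
def IsSubalg (f : AlternatingMap F L L (Fin (n + 2))) (K : Submodule F L) : Prop :=
  ∀ a : Fin (n + 2) → L, (∀ i, a i ∈ K) → f a ∈ K

/-- `K` is an ideal of `L` : `[K,L,…,L] ⊆ K`. -/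
def IsIdeal (f : AlternatingMap F L L (Fin (n + 2))) (K : Submodule F L) : Prop :=
  ∀ a : Fin (n + 2) → L, a 0 ∈ K → f a ∈ K

/-- `V` is an ideal of the subalgebra `W`. -/
def IsIdealIn (f : AlternatingMap F L L (Fin (n + 2))) (V W : Submodule F L) : Prop :=
  V ≤ W ∧ ∀ a : Fin (n + 2) → L, a 0 ∈ V → (∀ i, a i ∈ W) → f a ∈ V

/-- `M` is a maximal proper subalgebra of `L`. -/
def IsMaximalSubalg (f : AlternatingMap F L L (Fin (n + 2))) (M : Submodule F L) : Prop :=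
  IsSubalg f M ∧ M ≠ ⊤ ∧ ∀ U : Submodule F L, IsSubalg f U → M < U → U = ⊤

/-- The Frattini subalgebra: the intersection of all maximal proper subalgebras. -/
def frattini (f : AlternatingMap F L L (Fin (n + 2))) : Submodule F L :=
  sInf {M | IsMaximalSubalg f M}

/-- The lower central series of a subalgebra `U`:
`U¹ = U`, `U^{s+1} = [Uˢ, U,…,U]`. (`lcsIn f U s` is `U^{s+1}`.) -/
def lcsIn (f : AlternatingMap F L L (Fin (n + 2))) (U : Submodule F L) : ℕ → Submodule F L
  | 0 => U
  | s + 1 => bracketSpan f (Fin.cons (lcsIn f U s) fun _ => U)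

/-- `L` is a nilpotent `(n+2)`-Lie algebra. -/
def IsNilpotentAlg (f : AlternatingMap F L L (Fin (n + 2))) : Prop :=
  ∃ r, lcsIn f ⊤ r = ⊥

/-- The lower central series of `U` modulo `K`: `U/K` is nilpotent iff some term
of this series is contained in `K`. -/
def lcsMod (f : AlternatingMap F L L (Fin (n + 2))) (U K : Submodule F L) : ℕ → Submodule F L
  | 0 => U
  | s + 1 => bracketSpan f (Fin.cons (lcsMod f U K s) fun _ => U) ⊔ K

/-- The series `K¹ = K`, `K^{s+1} = [Kˢ, K, L,…,L]` used to define
"2-nilpotently embedded". -/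
def nes2 (f : AlternatingMap F L L (Fin (n + 2))) (K : Submodule F L) : ℕ → Submodule F L
  | 0 => K
  | s + 1 => bracketSpan f (Fin.cons (nes2 f K s) (Fin.cons K fun _ => ⊤))

/-- The series of `B` modulo `A`, so that `B/A` is 2-nilpotently embedded in `L/A`
iff some term of this series is contained in `A`. -/
def nes2Mod (f : AlternatingMap F L L (Fin (n + 2))) (B A : Submodule F L) : ℕ → Submodule F L
  | 0 => B
  | s + 1 => bracketSpan f (Fin.cons (nes2Mod f B A s) (Fin.cons B fun _ => ⊤)) ⊔ A

/-- The 2-derived series: `L⁽⁰⁾ = L`, `L⁽ˢ⁺¹⁾ = [L⁽ˢ⁾, L⁽ˢ⁾, L,…,L]`. -/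
def ds2 (f : AlternatingMap F L L (Fin (n + 2))) : ℕ → Submodule F L
  | 0 => ⊤
  | s + 1 => bracketSpan f (Fin.cons (ds2 f s) (Fin.cons (ds2 f s) fun _ => ⊤))

/-- `L` is 2-soluble. -/
def Is2Soluble (f : AlternatingMap F L L (Fin (n + 2))) : Prop :=
  ∃ r, ds2 f r = ⊥

/-- The `k`-derived series of an ideal `K`:
`K⁽⁰⁾ = K`, `K⁽ˢ⁺¹⁾ = [(k)K⁽ˢ⁾, (n+2-k)L]`: `K` is `k`-solubly embedded in `L`
iff some term vanishes. -/
def dsk (f : AlternatingMap F L L (Fin (n + 2))) (k : ℕ) (K : Submodule F L) :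
    ℕ → Submodule F L
  | 0 => K
  | s + 1 => bracketSpan f (fun i => if (i : ℕ) < k then dsk f k K s else ⊤)

/-- The `k`-derived series of `A` modulo `B`: `A/B` is `k`-solubly embedded in `L/B`
iff some term of this series is contained in `B`. -/
def dskMod (f : AlternatingMap F L L (Fin (n + 2))) (k : ℕ) (A B : Submodule F L) :
    ℕ → Submodule F L
  | 0 => A
  | s + 1 => bracketSpan f (fun i => if (i : ℕ) < k then dskMod f k A B s else ⊤) ⊔ B

/-- The ideal `A` is abelian embedded in `L`: `[A,A,L,…,L] = 0`. -/
def IsAbelianEmbedded (f : AlternatingMap F L L (Fin (n + 2))) (A : Submodule F L) : Prop :=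
  ∀ a : Fin (n + 2) → L, a 0 ∈ A → a 1 ∈ A → f a = 0

/-- `A` is a minimal abelian embedded ideal of `L`: a nonzero abelian embedded ideal
whose only properly contained ideal is `0`. -/
def IsMinAbelianEmbeddedIdeal (f : AlternatingMap F L L (Fin (n + 2)))
    (A : Submodule F L) : Prop :=
  A ≠ ⊥ ∧ IsIdeal f A ∧ IsAbelianEmbedded f A ∧
    ∀ B : Submodule F L, IsIdeal f B → B < A → B = ⊥

/-- The normalizer `N_L(U) = {x ∈ L ∣ [x,u₁,…,u_{n+1}] ∈ U for all uᵢ ∈ U}`. -/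
def normalizer (f : AlternatingMap F L L (Fin (n + 2))) (U : Submodule F L) : Set L :=
  {x | ∀ u : Fin (n + 1) → L, (∀ i, u i ∈ U) → f (Fin.cons x u) ∈ U}

/-- The centralizer `C_L(A) = {c ∈ L ∣ [c,a,x₃,…,x_{n+2}] = 0 for all a ∈ A, xᵢ ∈ L}`. -/
def centralizer (f : AlternatingMap F L L (Fin (n + 2))) (A : Submodule F L) : Set L :=
  {c | ∀ a ∈ A, ∀ x : Fin n → L, f (Fin.cons c (Fin.cons a x)) = 0}

/-- `S` is a Cartan subalgebra of `L`: a nilpotent self-normalizing subalgebra. -/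
def IsCartan (f : AlternatingMap F L L (Fin (n + 2))) (S : Submodule F L) : Prop :=
  IsSubalg f S ∧ (∃ r, lcsIn f S r = ⊥) ∧ normalizer f S = (S : Set L)

/-- `U` is a subnormal subalgebra of `L`. -/
def IsSubnormal (f : AlternatingMap F L L (Fin (n + 2))) (U : Submodule F L) : Prop :=
  ∃ (r : ℕ) (C : ℕ → Submodule F L), C 0 = U ∧ C r = ⊤ ∧
    (∀ i ≤ r, IsSubalg f (C i)) ∧ ∀ i < r, IsIdealIn f (C i) (C (i + 1))

/-- An `A`-inner automorphism: a finite product of maps `1 + D(a,x₂,…,x_{n+1})`,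
`a ∈ A`, where `A` is an abelian embedded ideal. -/
def IsAInner (f : AlternatingMap F L L (Fin (n + 2))) (A : Submodule F L)
    (α : L →ₗ[F] L) : Prop :=
  ∃ (m : ℕ) (g : Fin m → (L →ₗ[F] L)),
    (∀ j, ∃ (a : L) (x : Fin n → L), a ∈ A ∧ g j = LinearMap.id + D f (Fin.cons a x)) ∧
    α = (List.ofFn g).prod


open Polynomial in
/-- In finite dimension, a `d`-invariant subspace containing the Fitting null component of `d`
contains every vector that `d` sends into it. -/
theorem mem_of_apply_mem_of_engel_le [FiniteDimensional F L] {d : L →ₗ[F] L} {U : Submodule F L}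
    (hdU : U ≤ U.comap d) (hE : engel d ≤ U) {x : L} (hx : d x ∈ U) : x ∈ U := by
  obtain ⟨q, hq, hq0⟩ := exists_eq_pow_rootMultiplicity_mul_and_not_dvd
    (minpoly F d) (minpoly.ne_zero (Algebra.IsIntegral.isIntegral d)) 0
  rw [C_0, sub_zero, X_dvd_iff] at hq0
  rw [C_0, sub_zero] at hq
  have hqx : aeval d q x ∈ U := by
    refine hE ⟨(minpoly F d).rootMultiplicity 0, ?_⟩
    have h := minpoly.aeval F d
    rw [hq, map_mul, map_pow, aeval_X] at h
    exact LinearMap.congr_fun h x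
  have hdecomp : aeval d q x = aeval d q.divX (d x) + q.coeff 0 • x := by
    conv_lhs => rw [← divX_mul_X_add q]
    simp [Module.algebraMap_end_apply]
  have hmem := aeval_apply_smul_mem_of_le_comap hx q.divX d hdU
  rw [hdecomp] at hqx
  exact (U.smul_mem_iff hq0).1 ((U.add_mem_iff_right hmem).1 hqx)

/-- An inner derivation with arguments in `U` sends the normalizer of `U` into `U`. -/
theorem Dspan_apply_mem_of_mem_normalizer (f : AlternatingMap F L L (Fin (n + 2)))
    {U : Submodule F L} {d : L →ₗ[F] L} (hd : d ∈ Dspan f U) {x : L}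
    (hx : x ∈ normalizer f U) : d x ∈ U := by
  induction hd using Submodule.span_induction with
  | mem d hd =>
    obtain ⟨a, ha, rfl⟩ := hd
    change f (Fin.snoc a x) ∈ U
    rw [Fin.snoc_eq_cons_rotate]
    have h := f.map_perm (Fin.cons x a) (finRotate (n + 2))
    simp only [Function.comp_def] at h
    rw [h, Units.smul_def]
    exact zsmul_mem (hx a ha) _
  | zero => exact U.zero_mem
  | add d e _ _ hd he => exact U.add_mem hd he
  | smul c d _ hd => exact U.smul_mem c hd

theorem subset_normalizer (f : AlternatingMap F L L (Fin (n + 2))) {U : Submodule F L}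
    (hU : IsSubalg f U) : (U : Set L) ⊆ normalizer f U :=
  fun _ hx _ hu => hU _ (Fin.cases hx hu)

theorem Dspan_mono (f : AlternatingMap F L L (Fin (n + 2))) {E U : Submodule F L}
    (h : E ≤ U) : Dspan f E ≤ Dspan f U :=
  Submodule.span_mono fun _ ⟨a, ha, hd⟩ => ⟨a, fun i => h (ha i), hd⟩

/-- If `E = E_L(d)` is an Engel subalgebra of `L` and `U` is a subalgebra
with `E ⊆ U`, then `N_L(U) = U`. -/
theorem stmt1 {F : Type*} [Field F] {L : Type*} [AddCommGroup L] [Module F L]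
    [FiniteDimensional F L] {n : ℕ} (f : AlternatingMap F L L (Fin (n + 2)))
    (hf : IsNLie f) (E U : Submodule F L) (d : L →ₗ[F] L)
    (hdE : d ∈ Dspan f E) (hE : E = engel d)
    (hU : IsSubalg f U) (hEU : E ≤ U) :
    normalizer f U = (U : Set L) := by
  subst hE
  have hd := Dspan_mono f hEU hdE
  have hN : ∀ x ∈ normalizer f U, d x ∈ U := fun _ =>
    Dspan_apply_mem_of_mem_normalizer f hd
  refine Set.Subset.antisymm (fun x hx => ?_) (subset_normalizer f hU)
  exact mem_of_apply_mem_of_engel_le (fun y hy => hN y (subset_normalizer f hU hy)) hEU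
    (hN x hx)

end NLie
end

section
/- Let L be a finite-dimensional n-Lie algebra. If every maximal proper subalgebra of L is an ideal of L, then L is nilpotent. -/
namespace NLie

open Finset

variable {F : Type*} [Field F] {L : Type*} [AddCommGroup L] [Module F L] {n : ℕ}

/-- The right multiplication `v ↦ [v,a₁,…,a_k]`. -/
def rightMul {k : ℕ} (f : AlternatingMap F L L (Fin (k + 1))) (a : Fin k → L) :
    Module.End F L where
  toFun v := f.curryLeft v a
  map_add' x y := by simp only [map_add, AlternatingMap.add_apply]
  map_smul' c x := by simp only [map_smul, AlternatingMap.smul_apply, RingHom.id_apply]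

theorem rightMul_apply {k : ℕ} (f : AlternatingMap F L L (Fin (k + 1))) (a : Fin k → L) (v : L) :
    rightMul f a v = f (Fin.cons v a) := rfl

/-- All right multiplications of `f` are derivations of `f`; unlike `IsNLie`, this makes sense
for unary `f` as well. -/
def RightMulDerivation {k : ℕ} (f : AlternatingMap F L L (Fin (k + 1))) : Prop :=
  ∀ (a : Fin k → L) (x : Fin (k + 1) → L),
    rightMul f a (f x) = ∑ i, f (Function.update x i (rightMul f a (x i)))

theorem IsNLie.rightMulDerivation {f : AlternatingMap F L L (Fin (n + 2))} (hf : IsNLie f) :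
    RightMulDerivation f := by
  intro a x
  set e : ℤˣ := Equiv.Perm.sign (finRotate (n + 2))
  have key : ∀ z, f (Fin.snoc a z) = e • rightMul f a z := by
    intro z
    rw [rightMul_apply, ← AlternatingMap.map_perm, Fin.snoc_eq_cons_rotate]
    rfl
  have h := hf a x
  simp only [key] at h
  rcases Int.units_eq_one_or e with he | he
  · simpa [he] using h
  · have hneg : ∀ (i : Fin (n + 2)) (z : L),
        f (Function.update x i (-z)) = - f (Function.update x i z) := fun i z => by simp
    simpa [he, hneg] using h

theorem map_mem_iff_map_cons_mem {k : ℕ} (g : AlternatingMap F L L (Fin (k + 1)))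
    (Q : Submodule F L) (i : Fin (k + 1)) (b : Fin (k + 1) → L) :
    g b ∈ Q ↔ g (Fin.cons (b i) (Fin.tail (b ∘ Equiv.swap 0 i))) ∈ Q := by
  have h : (Fin.cons (b i) (Fin.tail (b ∘ Equiv.swap 0 i)) : Fin (k + 1) → L)
      = b ∘ Equiv.swap 0 i := by
    conv_rhs => rw [← Fin.cons_self_tail (b ∘ Equiv.swap 0 i)]
    simp
  rw [h, AlternatingMap.map_perm]
  rcases Int.units_eq_one_or (Equiv.Perm.sign (Equiv.swap 0 i)) with he | he <;> simp [he]

theorem tail_comp_swap_mem {k : ℕ} {i : Fin (k + 1)} {b : Fin (k + 1) → L} {U : Submodule F L}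
    (hb : ∀ j, j ≠ i → b j ∈ U) (j : Fin k) : Fin.tail (b ∘ Equiv.swap 0 i) j ∈ U := by
  refine hb _ fun h => ?_
  have h' : Equiv.swap 0 i j.succ = Equiv.swap 0 i 0 := by rw [Equiv.swap_apply_left]; exact h
  exact Fin.succ_ne_zero j ((Equiv.swap 0 i).injective h')

theorem map_swap_cons {k : ℕ} (f : AlternatingMap F L L (Fin (k + 2))) (x y : L) (a : Fin k → L) :
    f (Fin.cons x (Fin.cons y a)) = - f (Fin.cons y (Fin.cons x a)) := by
  rw [← f.map_swap (Fin.cons y (Fin.cons x a)) (i := 0) (j := 1) (by simp)]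
  congr 1
  ext j
  refine Fin.cases ?_ (fun j => Fin.cases ?_ (fun j => ?_) j) j
  · simp
  · simp
  · simp [Equiv.swap_apply_of_ne_of_ne, Fin.ext_iff]

/-- To evaluate an alternating map on `U + Fx` it is enough to let `x` occur at most once. -/
theorem map_mem_of_mem_sup_span {k : ℕ} (g : AlternatingMap F L L (Fin (k + 1)))
    {U Q : Submodule F L} {x : L}
    (hU : ∀ b : Fin (k + 1) → L, (∀ i, b i ∈ U) → g b ∈ Q)
    (hx : ∀ a : Fin k → L, (∀ i, a i ∈ U) → g (Fin.cons x a) ∈ Q)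
    (b : Fin (k + 1) → L) (hb : ∀ i, b i ∈ U ⊔ Submodule.span F {x}) : g b ∈ Q := by
  have split : ∀ (b : Fin (k + 1) → L) (j), b j ∈ U ⊔ Submodule.span F {x} →
      ∃ u ∈ U, ∃ c : F, g b = g (Function.update b j u) + c • g (Function.update b j x) := by
    intro b j hj
    obtain ⟨u, hu, y, hy, huy⟩ := Submodule.mem_sup.1 hj
    obtain ⟨c, rfl⟩ := Submodule.mem_span_singleton.1 hy
    refine ⟨u, hu, c, ?_⟩
    rw [← g.map_update_smul, ← g.map_update_add, huy, Function.update_eq_self]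
  have once : ∀ (i : Fin (k + 1)) (s : Finset (Fin (k + 1))) (b : Fin (k + 1) → L), b i = x →
      (∀ j, b j ∈ U ⊔ Submodule.span F {x}) → (∀ j, j ∉ s → j ≠ i → b j ∈ U) → g b ∈ Q := by
    intro i s
    induction s using Finset.induction with
    | empty =>
      intro b hi _ hb
      rw [map_mem_iff_map_cons_mem g Q i, hi]
      exact hx _ (tail_comp_swap_mem fun j hj => hb j (by simp) hj)
    | insert j s _ ih =>
      intro b hi hW hb
      by_cases hji : j = i
      · exact ih b hi hW fun l hl hli => hb l (by simp [hl, hji, hli]) hli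
      obtain ⟨u, hu, c, h⟩ := split b j (hW j)
      have h0 : g (Function.update b j x) = 0 :=
        g.map_eq_zero_of_eq _ (i := j) (j := i) (by simp [Ne.symm hji, hi]) hji
      rw [h, h0, smul_zero, add_zero]
      refine ih _ (by simp [Ne.symm hji, hi]) (fun l => ?_) (fun l hl hli => ?_)
      · by_cases hl : l = j
        · subst hl; simpa using Submodule.mem_sup_left hu
        · simpa [hl] using hW l
      · by_cases hlj : l = j
        · subst hlj; simpa using hu
        · simpa [hlj] using hb l (by simp [hl, hlj]) hli
  have any : ∀ (s : Finset (Fin (k + 1))) (b : Fin (k + 1) → L),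
      (∀ j, b j ∈ U ⊔ Submodule.span F {x}) → (∀ j, j ∉ s → b j ∈ U) → g b ∈ Q := by
    intro s
    induction s using Finset.induction with
    | empty => exact fun b _ hb => hU b fun j => hb j (by simp)
    | insert j s _ ih =>
      intro b hW hb
      obtain ⟨u, hu, c, h⟩ := split b j (hW j)
      rw [h]
      refine Q.add_mem (ih _ (fun l => ?_) (fun l hl => ?_))
        (Q.smul_mem c (once j univ _ (by simp) (fun l => ?_) (by simp)))
      · by_cases hl : l = j
        · subst hl; simpa using Submodule.mem_sup_left hu
        · simpa [hl] using hW l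
      · by_cases hlj : l = j
        · subst hlj; simpa using hu
        · simpa [hlj] using hb l (by simp [hl, hlj])
      · by_cases hl : l = j
        · subst hl; simpa using Submodule.mem_sup_right (Submodule.mem_span_singleton_self x)
        · simpa [hl] using hW l
  exact any univ b hb (by simp)

/-- A set of endomorphisms is strictly triangularizable. -/
def StrictlyTriangular (S : Set (Module.End F L)) : Prop :=
  ∃ (Z : ℕ → Submodule F L) (N : ℕ), Z 0 = ⊥ ∧ Z N = ⊤ ∧ ∀ k, ∀ s ∈ S, ∀ v ∈ Z (k + 1), s v ∈ Z k

theorem StrictlyTriangular.mono {S T : Set (Module.End F L)} (hT : StrictlyTriangular T)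
    (h : S ⊆ T) : StrictlyTriangular S := by
  obtain ⟨Z, N, h0, hN, hZ⟩ := hT
  exact ⟨Z, N, h0, hN, fun k s hs => hZ k s (h hs)⟩

theorem StrictlyTriangular.exists_mem_notMem {S : Set (Module.End F L)} (hS : StrictlyTriangular S)
    {U V : Submodule F L} (hUV : U < V) (hV : ∀ s ∈ S, ∀ v ∈ V, s v ∈ V) :
    ∃ x ∈ V, x ∉ U ∧ ∀ s ∈ S, s x ∈ U := by
  classical
  obtain ⟨Z, N, h0, hN, hZ⟩ := hS
  have hex : ∃ k, ¬ Z k ⊓ V ≤ U := ⟨N, by simpa [hN] using hUV.not_ge⟩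
  obtain ⟨k, hk⟩ : ∃ k, Nat.find hex = k + 1 := by
    refine Nat.exists_eq_succ_of_ne_zero fun h => Nat.find_spec hex ?_
    simp [h, h0]
  have hsp := Nat.find_spec hex
  rw [hk] at hsp
  obtain ⟨x, hx, hxU⟩ := SetLike.not_le_iff_exists.1 hsp
  refine ⟨x, hx.2, hxU, fun s hs => ?_⟩
  have hmin := not_not.1 (Nat.find_min hex (m := k) (by omega))
  exact hmin ⟨hZ k s hs x hx.1, hV s hs x hx.2⟩

/-- The submodule of vectors mapped into `U` by every element of `S`. -/
def annihilatedMod (S : Set (Module.End F L)) (U : Submodule F L) : Submodule F L where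
  carrier := {v | ∀ s ∈ S, s v ∈ U}
  zero_mem' := by simp
  add_mem' := fun ha hb s hs => by simpa using U.add_mem (ha s hs) (hb s hs)
  smul_mem' := fun c v hv s hs => by simpa using U.smul_mem c (hv s hs)

theorem mem_annihilatedMod {S : Set (Module.End F L)} {U : Submodule F L} {v : L} :
    v ∈ annihilatedMod S U ↔ ∀ s ∈ S, s v ∈ U := Iff.rfl

theorem strictlyTriangular_of_exists [FiniteDimensional F L] {S : Set (Module.End F L)}
    (h : ∀ U : Submodule F L, U ≠ ⊤ → (∀ s ∈ S, ∀ u ∈ U, s u ∈ U) →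
      ∃ x, x ∉ U ∧ ∀ s ∈ S, s x ∈ U) : StrictlyTriangular S := by
  let Z : ℕ → Submodule F L := fun k => (annihilatedMod S)^[k] ⊥
  have hsucc : ∀ k, Z (k + 1) = annihilatedMod S (Z k) := fun k =>
    Function.iterate_succ_apply' _ _ _
  have hle : ∀ k, Z k ≤ Z (k + 1) := by
    intro k
    induction k with
    | zero => exact bot_le
    | succ k ih =>
      intro v hv
      rw [hsucc] at hv ⊢
      exact fun s hs => ih (hv s hs)
  obtain ⟨N, hN⟩ := WellFoundedGT.monotone_chain_condition ⟨Z, monotone_nat_of_le_succ hle⟩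
  have hstab : Z N = Z (N + 1) := hN (N + 1) (Nat.le_succ N)
  refine ⟨Z, N, rfl, ?_, fun k s hs v hv => ?_⟩
  · by_contra hne
    obtain ⟨x, hx, hxs⟩ := h (Z N) hne fun s hs u hu => by
      rw [hstab, hsucc] at hu
      exact hu s hs
    rw [hstab, hsucc] at hx
    exact hx hxs
  · rw [hsucc] at hv
    exact hv s hs

/-- The operators `v ↦ [v,u₁,…,u_k]` with all `uᵢ ∈ U`. -/
def rightMuls {k : ℕ} (f : AlternatingMap F L L (Fin (k + 1))) (U : Submodule F L) :
    Set (Module.End F L) :=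
  {s | ∃ a : Fin k → L, (∀ i, a i ∈ U) ∧ s = rightMul f a}

/-- Fixing one argument lowers the arity; the sign makes `x` the second argument. -/
theorem rightMul_neg_curryLeft {k : ℕ} (f : AlternatingMap F L L (Fin (k + 2))) (x : L)
    (a : Fin k → L) : rightMul (-f.curryLeft x) a = rightMul f (Fin.cons x a) := by
  ext v
  rw [rightMul_apply, rightMul_apply, map_swap_cons]
  rfl

theorem RightMulDerivation.neg_curryLeft {k : ℕ} {f : AlternatingMap F L L (Fin (k + 2))}
    (hf : RightMulDerivation f) (x : L) : RightMulDerivation (-f.curryLeft x) := by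
  intro a y
  have hg : ∀ z, (-f.curryLeft x) z = - f (Fin.cons x z) := fun z => rfl
  have h0 : rightMul f (Fin.cons x a) x = 0 := by
    rw [rightMul_apply]
    exact f.map_eq_zero_of_eq _ (i := 0) (j := 1) (by simp) (by simp)
  simp only [rightMul_neg_curryLeft, hg, map_neg]
  rw [hf, Fin.sum_univ_succ]
  simp [h0, Fin.cons_update, f.map_coord_zero (m := Fin.cons 0 y) 0 rfl]

theorem RightMulDerivation.rightMul_comm {k : ℕ} {f : AlternatingMap F L L (Fin (k + 1))}
    (hf : RightMulDerivation f) (a b : Fin k → L) (v : L) :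
    rightMul f b (rightMul f a v) = rightMul f a (rightMul f b v) +
      ∑ i, rightMul f (Function.update a i (rightMul f b (a i))) v := by
  rw [rightMul_apply f a v, hf, Fin.sum_univ_succ]
  simp [Fin.cons_update, rightMul_apply]

/-- Engel's theorem: if all right multiplications are nilpotent, they are simultaneously
strictly triangularizable. -/
theorem strictlyTriangular_rightMuls [FiniteDimensional F L] {k : ℕ}
    {f : AlternatingMap F L L (Fin (k + 1))} (hf : RightMulDerivation f)
    (hnil : ∀ a, IsNilpotent (rightMul f a)) : StrictlyTriangular (rightMuls f ⊤) := by
  induction k with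
  | zero =>
    obtain ⟨N, hN⟩ := hnil 0
    refine ⟨fun k => LinearMap.ker (rightMul f 0 ^ k), N, ?_, ?_, ?_⟩
    · simp [Module.End.one_eq_id]
    · exact LinearMap.ker_eq_top.2 hN
    · rintro k _ ⟨a, -, rfl⟩ v hv
      rw [Subsingleton.elim a 0]
      rw [LinearMap.mem_ker] at hv ⊢
      rwa [← Module.End.mul_apply, ← pow_succ]
  | succ k ih =>
    let P : Set (Submodule F L) :=
      {U | (∀ b : Fin (k + 2) → L, (∀ i, b i ∈ U) → f b ∈ U) ∧ StrictlyTriangular (rightMuls f U)}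
    have hbot : (⊥ : Submodule F L) ∈ P := by
      refine ⟨fun b hb => ?_, fun k => if k = 0 then ⊥ else ⊤, 1, by simp, by simp, ?_⟩
      · rw [f.map_coord_zero 0 (by simpa using hb 0)]
        exact zero_mem _
      · rintro j _ ⟨a, ha, rfl⟩ v -
        rw [rightMul_apply, f.map_coord_zero 1 (by simpa using ha 0)]
        exact zero_mem _
    obtain ⟨U, ⟨hUsub, hUtri⟩, hmax⟩ := WellFounded.has_min
      (wellFounded_gt : WellFounded ((· > ·) : Submodule F L → Submodule F L → Prop)) P ⟨⊥, hbot⟩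
    by_cases hU : U = ⊤
    · exact hU ▸ hUtri
    exfalso
    obtain ⟨x, -, hxU, hx⟩ := hUtri.exists_mem_notMem (lt_top_iff_ne_top.2 hU) (by simp)
    have hx' : ∀ a : Fin (k + 1) → L, (∀ i, a i ∈ U) → f (Fin.cons x a) ∈ U :=
      fun a ha => hx _ ⟨a, ha, rfl⟩
    have hUW : U ≤ U ⊔ Submodule.span F {x} := le_sup_left
    have hxW : x ∈ U ⊔ Submodule.span F {x} :=
      Submodule.mem_sup_right (Submodule.mem_span_singleton_self x)
    refine hmax (U ⊔ Submodule.span F {x}) ⟨fun b hb => hUW ?_, ?_⟩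
      (lt_of_le_of_ne hUW fun h => hxU (h ▸ hxW))
    · exact map_mem_of_mem_sup_span f hUsub hx' b hb
    refine strictlyTriangular_of_exists fun V hV hVinv => ?_
    have htri := (ih (hf.neg_curryLeft x) fun a => rightMul_neg_curryLeft f x a ▸ hnil _).mono
      (S := rightMuls (-f.curryLeft x) U) (by rintro _ ⟨a, -, rfl⟩; exact ⟨a, by simp, rfl⟩)
    have hVU : ∀ s ∈ rightMuls f U, ∀ v ∈ V, s v ∈ V := by
      rintro _ ⟨a, ha, rfl⟩
      exact hVinv _ ⟨a, fun i => hUW (ha i), rfl⟩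
    have hVlt : V < annihilatedMod (rightMuls f U) V := by
      refine lt_of_le_of_ne (fun v hv s hs => hVU s hs v hv) fun h => ?_
      obtain ⟨y, -, hyV, hy⟩ := hUtri.exists_mem_notMem (lt_top_iff_ne_top.2 hV) (by simp)
      rw [h] at hyV
      exact hyV hy
    obtain ⟨y, hyU, hyV, hyx⟩ := htri.exists_mem_notMem hVlt (by
      rintro _ ⟨b, hb, rfl⟩ v hv _ ⟨a, ha, rfl⟩
      rw [rightMul_neg_curryLeft]
      have hxb : ∀ u ∈ U, rightMul f (Fin.cons x b) u ∈ U := fun u hu => by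
        rw [rightMul_apply, map_swap_cons]
        exact U.neg_mem (hx' _ (Fin.cases hu hb))
      have hcomm := hf.rightMul_comm a (Fin.cons x b) v
      rw [← sub_eq_iff_eq_add] at hcomm
      rw [← hcomm]
      refine V.sub_mem (hVinv _ ⟨_, Fin.cases hxW fun i => hUW (hb i), rfl⟩ _ (hv _ ⟨a, ha, rfl⟩))
        (V.sum_mem fun i _ => hv _ ⟨_, fun j => ?_, rfl⟩)
      by_cases hj : j = i
      · subst hj; simpa using hxb _ (ha j)
      · simpa [hj] using ha j)
    refine ⟨y, hyV, ?_⟩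
    rintro _ ⟨a, ha, rfl⟩
    refine map_mem_of_mem_sup_span (f.curryLeft y) (fun b hb => hyU _ ⟨b, hb, rfl⟩)
      (fun b hb => ?_) a ha
    have := hyx _ ⟨b, hb, rfl⟩
    rwa [rightMul_neg_curryLeft] at this

theorem IsDerivation.isSubalg_engel {f : AlternatingMap F L L (Fin (n + 2))} {d : L →ₗ[F] L}
    (hd : IsDerivation f d) : IsSubalg f (engel d) := by
  intro b hb
  choose r hr using hb
  generalize hN : ∑ i, r i = N
  induction N generalizing b r with
  | zero =>
    have h0 : b 0 = 0 := by
      have := hr 0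
      rwa [(Finset.sum_eq_zero_iff.1 hN) 0 (mem_univ _), pow_zero] at this
    rw [f.map_coord_zero 0 h0]
    exact zero_mem _
  | succ N ih =>
    suffices h : d (f b) ∈ engel d by
      obtain ⟨m, hm⟩ := h
      exact ⟨m + 1, by rwa [pow_succ]⟩
    rw [hd]
    refine Submodule.sum_mem _ fun i _ => ?_
    rcases Nat.eq_zero_or_pos (r i) with h0 | hpos
    · have hi : b i = 0 := by simpa [h0] using hr i
      simp [hi]
    · refine ih _ (Function.update r i (r i - 1)) (fun j => ?_) ?_
      · by_cases hj : j = i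
        · subst hj
          have := hr j
          rw [← Nat.sub_add_cancel hpos, pow_succ] at this
          simpa using this
        · simpa [hj] using hr j
      · have h1 := Finset.add_sum_erase univ r (mem_univ i)
        have h2 := Finset.add_sum_erase univ (Function.update r i (r i - 1)) (mem_univ i)
        have h3 : ∑ j ∈ univ.erase i, Function.update r i (r i - 1) j = ∑ j ∈ univ.erase i, r j :=
          Finset.sum_congr rfl fun j hj => by simp [Finset.ne_of_mem_erase hj]
        rw [h3] at h2
        simp only [Function.update_self] at h2
        omega

theorem exists_isMaximalSubalg_ge [FiniteDimensional F L] {f : AlternatingMap F L L (Fin (n + 2))}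
    {E : Submodule F L} (hE : IsSubalg f E) (hne : E ≠ ⊤) : ∃ M, IsMaximalSubalg f M ∧ E ≤ M := by
  obtain ⟨M, ⟨hM, hMtop, hEM⟩, hmax⟩ := WellFounded.has_min
    (wellFounded_gt : WellFounded ((· > ·) : Submodule F L → Submodule F L → Prop))
    {M | IsSubalg f M ∧ M ≠ ⊤ ∧ E ≤ M} ⟨E, hE, hne, le_rfl⟩
  refine ⟨M, ⟨hM, hMtop, fun U hU hMU => ?_⟩, hEM⟩
  by_contra hUtop
  exact hmax U ⟨hU, hUtop, hEM.trans hMU.le⟩ hMU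

theorem engel_sup_range [FiniteDimensional F L] (d : L →ₗ[F] L) :
    engel d ⊔ LinearMap.range d = ⊤ := by
  obtain ⟨m, hm, hpos⟩ := (((LinearMap.eventually_codisjoint_ker_pow_range_pow
    (f := (d : Module.End F L))).and (Filter.eventually_gt_atTop 0))).exists
  obtain ⟨m, rfl⟩ := Nat.exists_eq_succ_of_ne_zero hpos.ne'
  refine top_unique (hm.eq_top.symm.le.trans (sup_le_sup (fun v hv => ⟨_, hv⟩) ?_))
  rintro _ ⟨v, rfl⟩
  rw [pow_succ']
  exact ⟨_, rfl⟩

theorem isNilpotent_rightMul [FiniteDimensional F L] {f : AlternatingMap F L L (Fin (n + 2))}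
    (hf : RightMulDerivation f) (h : ∀ M : Submodule F L, IsMaximalSubalg f M → IsIdeal f M)
    (a : Fin (n + 1) → L) : IsNilpotent (rightMul f a) := by
  by_contra hnil
  have hne : engel (rightMul f a) ≠ ⊤ := fun htop =>
    hnil (Module.End.isNilpotent_iff_of_finite.2 fun v =>
      (htop ▸ Submodule.mem_top : v ∈ engel (rightMul f a)))
  obtain ⟨M, hM, hEM⟩ := exists_isMaximalSubalg_ge (IsDerivation.isSubalg_engel (hf a)) hne
  have ha : a 0 ∈ M := hEM ⟨1, by
    rw [pow_one, rightMul_apply]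
    exact f.map_eq_zero_of_eq _ (i := 0) (j := 1) (by simp) (by simp)⟩
  refine hM.2.1 (top_unique ((engel_sup_range (rightMul f a)).symm.le.trans (sup_le hEM ?_)))
  rintro _ ⟨v, rfl⟩
  rw [rightMul_apply, ← Fin.cons_self_tail a, map_swap_cons]
  exact M.neg_mem (h M hM _ ha)

theorem isNilpotentAlg_of_strictlyTriangular {f : AlternatingMap F L L (Fin (n + 2))}
    (hf : StrictlyTriangular (rightMuls f ⊤)) : IsNilpotentAlg f := by
  obtain ⟨Z, N, h0, hN, hZ⟩ := hf
  have hle : ∀ r k, r + k = N → lcsIn f ⊤ r ≤ Z k := by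
    intro r
    induction r with
    | zero => rintro k hk; simp [show k = N by omega, hN]
    | succ r ih =>
      intro k hk
      refine Submodule.span_le.2 ?_
      rintro _ ⟨a, ha, rfl⟩
      rw [← Fin.cons_self_tail a]
      exact hZ k _ ⟨_, by simp, rfl⟩ _ (ih (k + 1) (by omega) (ha 0))
  exact ⟨N, le_bot_iff.1 (h0 ▸ hle N 0 rfl)⟩

/-- If every maximal proper subalgebra of `L` is an ideal,
then `L` is nilpotent. -/
theorem stmt2 {F : Type*} [Field F] {L : Type*} [AddCommGroup L] [Module F L]
    [FiniteDimensional F L] {n : ℕ} (f : AlternatingMap F L L (Fin (n + 2)))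
    (hf : IsNLie f)
    (h : ∀ M : Submodule F L, IsMaximalSubalg f M → IsIdeal f M) :
    IsNilpotentAlg f := by
  exact isNilpotentAlg_of_strictlyTriangular (strictlyTriangular_rightMuls
    hf.rightMulDerivation (isNilpotent_rightMul hf.rightMulDerivation h))

end NLie
end

section
/- Let L be a finite-dimensional n-Lie algebra, let A be a minimal abelian embedded ideal of L, and suppose U is a proper subalgebra of L with U + A = L. Then U ∩ A = 0 and U is a maximal proper subalgebra of L. -/
namespace NLie

open Finset

variable {F : Type*} [Field F] {L : Type*} [AddCommGroup L] [Module F L] {n : ℕ}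

/-- The bracket vanishes as soon as the first slot and some other slot lie in `A`. -/
theorem IsAbelianEmbedded.map_eq_zero {f : AlternatingMap F L L (Fin (n + 2))}
    {A : Submodule F L} (hA : IsAbelianEmbedded f A) {x : Fin (n + 2) → L} {i : Fin (n + 2)}
    (hi : i ≠ 0) (h0 : x 0 ∈ A) (hxi : x i ∈ A) : f x = 0 := by
  have h : f (x ∘ Equiv.swap 1 i) = 0 := by
    refine hA _ ?_ ?_
    · rwa [Function.comp_apply, Equiv.swap_apply_of_ne_of_ne (by simp) hi.symm]
    · rwa [Function.comp_apply, Equiv.swap_apply_left]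
  rw [f.map_perm] at h
  exact (smul_eq_zero_iff_eq _).mp h

/-- If the first slot lies in `A`, the other slots only matter modulo `A`. -/
theorem IsAbelianEmbedded.map_congr {f : AlternatingMap F L L (Fin (n + 2))}
    {A : Submodule F L} (hA : IsAbelianEmbedded f A) {x u : Fin (n + 2) → L}
    (h0 : x 0 ∈ A) (hu0 : u 0 = x 0) (hu : ∀ i, u i - x i ∈ A) : f u = f x := by
  suffices h : ∀ s : Finset (Fin (n + 2)), f (s.piecewise u x) = f x by
    simpa using h Finset.univ
  intro s
  induction s using Finset.induction_on with
  | empty => simp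
  | insert i s his ih =>
    rw [Finset.piecewise_insert, ← ih]
    have hx : s.piecewise u x = Function.update (s.piecewise u x) i (x i) := by
      conv_lhs => rw [← Function.update_eq_self i (s.piecewise u x)]
      rw [Finset.piecewise_eq_of_notMem _ _ _ his]
    have hp0 : s.piecewise u x 0 = x 0 := by
      by_cases h : (0 : Fin (n + 2)) ∈ s <;> simp [h, hu0]
    rcases eq_or_ne i 0 with rfl | hi
    · rw [hu0, ← hx]
    · rw [← sub_eq_zero]
      conv_lhs => rw [hx]
      rw [Function.update_idem, ← f.map_update_sub]
      refine hA.map_eq_zero hi ?_ (by simpa using hu i)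
      rwa [Function.update_of_ne hi.symm, hp0]

/-- A subalgebra supplementing an abelian embedded ideal meets it in an ideal. -/
theorem IsSubalg.isIdeal_inf {f : AlternatingMap F L L (Fin (n + 2))} {A V : Submodule F L}
    (hV : IsSubalg f V) (hI : IsIdeal f A) (hA : IsAbelianEmbedded f A) (hVA : V ⊔ A = ⊤) :
    IsIdeal f (V ⊓ A) := by
  intro x hx
  refine ⟨?_, hI x hx.2⟩
  have key : ∀ i, ∃ u ∈ V, u - x i ∈ A ∧ (i = 0 → u = x i) := by
    intro i
    rcases eq_or_ne i 0 with rfl | hi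
    · exact ⟨x 0, hx.1, by simp, fun _ => rfl⟩
    · obtain ⟨v, hv, a, ha, hva⟩ := Submodule.mem_sup.mp (hVA ▸ Submodule.mem_top : x i ∈ V ⊔ A)
      exact ⟨v, hv, by simpa [← hva] using ha, fun h => absurd h hi⟩
  choose u huV huA hu0 using key
  rw [← hA.map_congr hx.2 (hu0 0 rfl) huA]
  exact hV u huV

/-- A proper subalgebra supplementing a minimal abelian embedded ideal meets it trivially. -/
theorem IsMinAbelianEmbeddedIdeal.inf_eq_bot {f : AlternatingMap F L L (Fin (n + 2))}
    {A V : Submodule F L} (hA : IsMinAbelianEmbeddedIdeal f A) (hV : IsSubalg f V)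
    (hVtop : V ≠ ⊤) (hVA : V ⊔ A = ⊤) : V ⊓ A = ⊥ := by
  obtain ⟨-, hI, hab, hmin⟩ := hA
  refine hmin _ (hV.isIdeal_inf hI hab hVA) (inf_lt_right.mpr fun h => hVtop ?_)
  rwa [sup_eq_left.mpr h] at hVA

/-- Let `A` be a minimal abelian embedded ideal of `L` and `U` a proper
subalgebra with `U + A = L`.  Then `U ∩ A = 0` and `U` is a maximal proper subalgebra. -/
theorem stmt6 {F : Type*} [Field F] {L : Type*} [AddCommGroup L] [Module F L]
    [FiniteDimensional F L] {n : ℕ} (f : AlternatingMap F L L (Fin (n + 2)))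
    (hf : IsNLie f) (A U : Submodule F L)
    (hA : IsMinAbelianEmbeddedIdeal f A)
    (hU : IsSubalg f U) (hUtop : U ≠ ⊤) (hUA : U ⊔ A = ⊤) :
    U ⊓ A = ⊥ ∧ IsMaximalSubalg f U := by
  refine ⟨hA.inf_eq_bot hU hUtop hUA, hU, hUtop, fun V hV hUV => ?_⟩
  by_contra hVtop
  have hVA : V ⊔ A = ⊤ := top_le_iff.mp (hUA ▸ sup_le_sup_right hUV.le A)
  refine hUV.ne ?_
  rw [← sup_bot_eq U, ← hA.inf_eq_bot hV hVtop hVA, inf_comm, ← sup_inf_assoc_of_le A hUV.le, hUA,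
    top_inf_eq]

end NLie
end

section
/- Let L be a finite-dimensional n-Lie algebra. If the inner derivation D(x1,…,x_{n-1}) is nilpotent as a linear map for all x1,…,x_{n-1} ∈ L, then L is nilpotent. -/
namespace NLie

open Finset

variable {F : Type*} [Field F] {L : Type*} [AddCommGroup L] [Module F L] {n : ℕ}

attribute [local instance] LieRing.ofAssociativeRing

theorem lt_normalizer_of_forall_isNilpotent {F V : Type*} [Field F] [AddCommGroup V] [Module F V]
    [FiniteDimensional F V] {G : LieSubalgebra F (Module.End F V)} {K : LieSubalgebra F G}
    (hK : ∀ x ∈ K, IsNilpotent (x : Module.End F V)) (hne : K ≠ ⊤) : K < K.normalizer := by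
  apply lt_of_le_of_ne K.le_normalizer
  rw [Ne, eq_comm, K.normalizer_eq_self_iff, ← Ne, ← LieSubmodule.nontrivial_iff_ne_bot F K]
  have : Nontrivial (G ⧸ K.toLieSubmodule) := Submodule.Quotient.nontrivial_iff.2 <| by simpa
  have : LieModule.IsNilpotent K (G ⧸ K.toLieSubmodule) := by
    refine LieAlgebra.isEngelian_of_isNoetherian (R := F) _ fun x => ?_
    have hx := LieAlgebra.isNilpotent_ad_of_isNilpotent (hK x x.2)
    apply Module.End.IsNilpotent.mapQ ?_ hx
    intro X HX
    simp only [LieSubalgebra.coe_toLieSubmodule, LieSubalgebra.mem_toSubmodule] at HX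
    simp only [LieSubalgebra.coe_toLieSubmodule, Submodule.mem_comap, LieAlgebra.ad_apply,
      LieSubalgebra.mem_toSubmodule]
    exact LieSubalgebra.lie_mem K x.prop HX
  exact LieModule.nontrivial_max_triv_of_isNilpotent F K (G ⧸ K.toLieSubmodule)

theorem exists_le_of_mem_normalizer {F V : Type*} [Field F] [AddCommGroup V] [Module F V]
    [FiniteDimensional F V] {G : LieSubalgebra F (Module.End F V)} {K : LieSubalgebra F G}
    (hK : ∀ x ∈ K, IsNilpotent (x : Module.End F V)) {x : G} (hx : x ∈ K.normalizer)
    (hxn : IsNilpotent (x : Module.End F V)) :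
    ∃ K' : LieSubalgebra F G, K ≤ K' ∧ x ∈ K' ∧ ∀ y ∈ K', IsNilpotent (y : Module.End F V) := by
  let K' : LieSubalgebra F G :=
    { (F ∙ x) ⊔ (K : Submodule F G) with
      lie_mem' := fun {y z} => LieSubalgebra.lie_mem_sup_of_mem_normalizer hx }
  have hxK' : x ∈ K' := Submodule.mem_sup_left (Submodule.subset_span (Set.mem_singleton _))
  have hKK' : K ≤ K' := (LieSubalgebra.toSubmodule_le_toSubmodule K K').mp le_sup_right
  have hK' : K' ≤ K.normalizer := by
    rw [← LieSubalgebra.toSubmodule_le_toSubmodule]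
    exact sup_le ((Submodule.span_singleton_le_iff_mem _ _).mpr hx) K.le_normalizer
  obtain ⟨I, hI₁ : (I : LieSubalgebra F K') = LieSubalgebra.ofLe hKK'⟩ :=
    LieSubalgebra.exists_nested_lieIdeal_ofLe_normalizer hKK' hK'
  have hI₂ : F ∙ (⟨x, hxK'⟩ : K') ⊔ LieSubmodule.toSubmodule I = ⊤ := by
    rw [← LieIdeal.toLieSubalgebra_toSubmodule F K' I, hI₁]
    apply Submodule.map_injective_of_injective (K' : Submodule F G).injective_subtype
    simp only [LieSubalgebra.coe_ofLe, Submodule.map_sup, Submodule.map_subtype_range_inclusion,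
      Submodule.map_top, Submodule.range_subtype]
    rw [Submodule.map_subtype_span_singleton]
  have hI : ∀ y : K', y ∈ I → (y : G) ∈ K := by
    intro y hy
    have : y ∈ LieSubalgebra.ofLe hKK' := by
      rw [← hI₁]; exact hy
    simpa [LieSubalgebra.mem_ofLe] using this
  have hnil : LieModule.IsNilpotent K' V := by
    refine LieSubmodule.isNilpotentOfIsNilpotentSpanSupEqTop hI₂ hxn ?_
    exact LieAlgebra.isEngelian_of_isNoetherian (R := F) _ fun y => hK _ (hI _ y.2)
  exact ⟨K', hKK', hxK', fun y hy => LieModule.isNilpotent_toEnd_of_isNilpotent F K' V ⟨y, hy⟩⟩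

/-- A Lie algebra of endomorphisms consists of nilpotent maps as soon as it has a subalgebra of
nilpotent maps each of whose cosets contains a nilpotent map. -/
theorem isNilpotent_of_forall_exists_sub_mem {F V : Type*} [Field F] [AddCommGroup V] [Module F V]
    [FiniteDimensional F V] {G : LieSubalgebra F (Module.End F V)} {A : LieSubalgebra F G}
    (hA : ∀ x ∈ A, IsNilpotent (x : Module.End F V))
    (hG : ∀ g : G, ∃ b : G, IsNilpotent (b : Module.End F V) ∧ g - b ∈ A) (g : G) :
    IsNilpotent (g : Module.End F V) := by
  obtain ⟨K, ⟨hAK, hK⟩, hmax⟩ := (LieSubalgebra.wellFoundedGT_of_noetherian F G).wf.has_min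
    {K : LieSubalgebra F G | A ≤ K ∧ ∀ x ∈ K, IsNilpotent (x : Module.End F V)} ⟨A, le_rfl, hA⟩
  suffices K = ⊤ from hK g (this ▸ LieSubalgebra.mem_top g)
  by_contra hne
  obtain ⟨c, hcN, hcK⟩ := SetLike.exists_of_lt (lt_normalizer_of_forall_isNilpotent hK hne)
  obtain ⟨b, hb, hcb⟩ := hG c
  have hbN : b ∈ K.normalizer := by
    simpa using sub_mem hcN (K.le_normalizer (hAK hcb))
  have hbK : b ∉ K := fun h => hcK (by simpa using add_mem (hAK hcb) h)
  obtain ⟨K', hKK', hbK', hK'⟩ := exists_le_of_mem_normalizer hK hbN hb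
  exact hmax K' ⟨hAK.trans hKK', hK'⟩
    (lt_of_le_of_ne hKK' fun h => hbK (h ▸ hbK'))

theorem exists_notMem_forall_apply_mem {F V : Type*} [Field F] [AddCommGroup V] [Module F V]
    [FiniteDimensional F V] {A : LieSubalgebra F (Module.End F V)}
    (hA : ∀ x ∈ A, IsNilpotent x) {M : Submodule F V} (hM : M ≠ ⊤) :
    ∃ x ∉ M, ∀ a ∈ A, a x ∈ M := by
  have : LieModule.IsNilpotent A V :=
    LieAlgebra.isEngelian_of_isNoetherian (R := F) _ fun y => hA _ y.2
  obtain ⟨k, hk⟩ := LieModule.IsNilpotent.nilpotent F A V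
  have hex : ∃ k, (LieModule.lowerCentralSeries F A V k : Submodule F V) ≤ M := ⟨k, by simp [hk]⟩
  classical
  obtain ⟨j, hj⟩ : ∃ j, Nat.find hex = j + 1 := Nat.exists_eq_succ_of_ne_zero fun h0 => by
    have := Nat.find_spec hex
    rw [h0] at this
    exact hM (by simpa using this)
  have h1 := Nat.find_spec hex
  rw [hj] at h1
  obtain ⟨x, hx, hxM⟩ := SetLike.not_le_iff_exists.1 (Nat.find_min hex (m := j) (by omega))
  refine ⟨x, hxM, fun a ha => h1 ?_⟩
  rw [LieModule.lowerCentralSeries_succ]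
  exact LieSubmodule.lie_mem_lie (LieSubmodule.mem_top (⟨a, ha⟩ : A)) hx

section Inner

variable {m : ℕ}

/-- The `(m+1)`-ary generalized Jacobi identity. -/
def IsJacobi (f : L [⋀^Fin (m + 1)]→ₗ[F] L) : Prop :=
  ∀ (y : Fin m → L) (x : Fin (m + 1) → L),
    f (Fin.snoc y (f x)) = ∑ i, f (Function.update x i (f (Fin.snoc y (x i))))

/-- The inner derivation of an `(m+1)`-ary bracket, as an alternating map. -/
def inner (f : L [⋀^Fin (m + 1)]→ₗ[F] L) : L [⋀^Fin m]→ₗ[F] Module.End F L where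
  toFun a :=
    { toFun := fun x => f (Fin.snoc a x)
      map_add' := fun x y => by
        have h := f.toMultilinearMap.map_update_add (Fin.snoc a x) (Fin.last m) x y
        simpa [Fin.update_snoc_last] using h
      map_smul' := fun c x => by
        have h := f.toMultilinearMap.map_update_smul (Fin.snoc a x) (Fin.last m) c x
        simpa [Fin.update_snoc_last] using h }
  map_update_add' {inst} a i x y := by
    rw [Subsingleton.elim inst (instDecidableEqFin m)]
    ext z
    simp [Fin.snoc_update]
  map_update_smul' {inst} a i c x := by
    rw [Subsingleton.elim inst (instDecidableEqFin m)]
    ext z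
    simp [Fin.snoc_update]
  map_eq_zero_of_eq' a i j hij hne := by
    ext z
    exact f.map_eq_zero_of_eq (i := i.castSucc) (j := j.castSucc) _ (by simpa using hij)
      (by simpa using hne)

theorem inner_apply (f : L [⋀^Fin (m + 1)]→ₗ[F] L) (a : Fin m → L) (x : L) :
    inner f a x = f (Fin.snoc a x) := rfl

theorem inner_curryLeft (f : L [⋀^Fin (m + 2)]→ₗ[F] L) (x : L) (a : Fin m → L) :
    inner (f.curryLeft x) a = inner f (Fin.cons x a) := by
  ext z
  rw [inner_apply, inner_apply, ← Fin.cons_snoc_eq_snoc_cons]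
  rfl

theorem IsJacobi.curryLeft {f : L [⋀^Fin (m + 2)]→ₗ[F] L} (hf : IsJacobi f) (x : L) :
    IsJacobi (f.curryLeft x) := by
  intro y z
  have h := hf (Fin.cons x y) (Fin.cons x z)
  have h0 : f (Fin.snoc (Fin.cons x y : Fin (m + 1) → L) x) = 0 :=
    f.map_eq_zero_of_eq (i := 0) (j := Fin.last _) _ (by
      rw [← Fin.cons_snoc_eq_snoc_cons, Fin.cons_zero, Fin.cons_snoc_eq_snoc_cons,
        Fin.snoc_last]) (Fin.last_pos.ne)
  rw [Fin.sum_univ_succ] at h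
  simp only [Fin.cons_zero, Fin.cons_succ, h0, ← Fin.cons_update] at h
  have h1 : f (Function.update (Fin.cons x z : Fin (m + 2) → L) 0 0) = 0 :=
    f.map_coord_zero 0 (by simp)
  rw [h1, zero_add] at h
  simp only [← Fin.cons_snoc_eq_snoc_cons] at h
  exact h

theorem IsJacobi.lie_inner {f : L [⋀^Fin (m + 1)]→ₗ[F] L} (hf : IsJacobi f) (a b : Fin m → L) :
    ⁅inner f a, inner f b⁆ = ∑ i, inner f (Function.update b i (inner f a (b i))) := by
  ext z
  have h := hf a (Fin.snoc b z)
  rw [Fin.sum_univ_castSucc] at h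
  simp only [Fin.snoc_castSucc, Fin.snoc_last, Fin.update_snoc_last, ← Fin.snoc_update] at h
  rw [Ring.lie_def, LinearMap.sub_apply, Module.End.mul_apply, Module.End.mul_apply,
    LinearMap.sum_apply]
  simp only [inner_apply]
  rw [h, add_sub_cancel_right]

/-- The span of the inner derivations with all entries in a subspace. -/
def innerSpan (f : L [⋀^Fin (m + 1)]→ₗ[F] L) (M : Submodule F L) :
    Submodule F (Module.End F L) :=
  Submodule.span F (inner f '' {a | ∀ i, a i ∈ M})

theorem inner_mem_innerSpan (f : L [⋀^Fin (m + 1)]→ₗ[F] L) {M : Submodule F L} {a : Fin m → L}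
    (ha : ∀ i, a i ∈ M) : inner f a ∈ innerSpan f M :=
  Submodule.subset_span ⟨a, ha, rfl⟩

theorem innerSpan_mono (f : L [⋀^Fin (m + 1)]→ₗ[F] L) {M N : Submodule F L} (h : M ≤ N) :
    innerSpan f M ≤ innerSpan f N :=
  Submodule.span_mono (Set.image_mono fun _ ha i => h (ha i))

/-- The inner derivations with entries in a subalgebra span a Lie algebra. -/
def innerLie {f : L [⋀^Fin (m + 1)]→ₗ[F] L} (hf : IsJacobi f) {M : Submodule F L}
    (hM : ∀ a : Fin (m + 1) → L, (∀ i, a i ∈ M) → f a ∈ M) :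
    LieSubalgebra F (Module.End F L) where
  __ := innerSpan f M
  lie_mem' {d e} hd he := by
    change d ∈ innerSpan f M at hd
    change e ∈ innerSpan f M at he
    change ⁅d, e⁆ ∈ innerSpan f M
    refine Submodule.span_induction₂ (p := fun d e _ _ => ⁅d, e⁆ ∈ innerSpan f M)
      ?_ ?_ ?_ ?_ ?_ ?_ ?_ hd he
    · rintro _ _ ⟨a, ha, rfl⟩ ⟨b, hb, rfl⟩
      rw [hf.lie_inner]
      refine Submodule.sum_mem _ fun i _ => inner_mem_innerSpan f fun j => ?_
      rcases eq_or_ne j i with rfl | hj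
      · rw [Function.update_self]
        refine hM _ fun k => ?_
        induction k using Fin.lastCases with
        | last => simpa using hb j
        | cast k => simpa using ha k
      · rw [Function.update_of_ne hj]
        exact hb j
    · intros; simp
    · intros; simp
    · intro _ _ _ _ _ _ h1 h2
      rw [add_lie]
      exact add_mem h1 h2
    · intro _ _ _ _ _ _ h1 h2
      rw [lie_add]
      exact add_mem h1 h2
    · intro c _ _ _ _ h1
      rw [smul_lie]
      exact Submodule.smul_mem _ c h1
    · intro c _ _ _ _ h1
      rw [lie_smul]
      exact Submodule.smul_mem _ c h1

theorem mem_innerLie {f : L [⋀^Fin (m + 1)]→ₗ[F] L} (hf : IsJacobi f) {M : Submodule F L}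
    (hM : ∀ a : Fin (m + 1) → L, (∀ i, a i ∈ M) → f a ∈ M) {d : Module.End F L} :
    d ∈ innerLie hf hM ↔ d ∈ innerSpan f M := Iff.rfl

theorem mem_of_comp_perm_mem {E : Type*} [AddCommGroup E] [Module F E]
    (g : L [⋀^Fin m]→ₗ[F] E) {T : Submodule F E} {v : Fin m → L} (σ : Equiv.Perm (Fin m))
    (h : g (v ∘ σ) ∈ T) : g v ∈ T := by
  rw [g.map_perm] at h
  rcases Int.units_eq_one_or (Equiv.Perm.sign σ) with hs | hs <;> simpa [hs] using h

theorem mem_of_forall_mem_sup_span {E : Type*} [AddCommGroup E] [Module F E]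
    (g : L [⋀^Fin m]→ₗ[F] E) {T : Submodule F E} {M : Submodule F L} {x : L}
    (hM : ∀ v : Fin m → L, (∀ i, v i ∈ M) → g v ∈ T)
    (hx : ∀ (v : Fin m → L) (i : Fin m), (∀ j, v j ∈ M ⊔ F ∙ x) → v i = x → g v ∈ T)
    (v : Fin m → L) (hv : ∀ i, v i ∈ M ⊔ F ∙ x) : g v ∈ T := by
  suffices ∀ (s : Finset (Fin m)) (v : Fin m → L), (∀ i, v i ∈ M ⊔ F ∙ x) →
      (∀ i ∉ s, v i ∈ M) → g v ∈ T from this Finset.univ v hv (by simp)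
  intro s
  induction s using Finset.induction_on with
  | empty => exact fun v _ h => hM v fun i => h i (by simp)
  | insert i s his ih =>
    intro v hv h
    obtain ⟨u, hu, w, hw, huw⟩ := Submodule.mem_sup.1 (hv i)
    obtain ⟨c, rfl⟩ := Submodule.mem_span_singleton.1 hw
    have hmem : ∀ z ∈ M ⊔ F ∙ x, ∀ j, Function.update v i z j ∈ M ⊔ F ∙ x := by
      intro z hz j
      rcases eq_or_ne j i with rfl | hj
      · simpa using hz
      · simpa [hj] using hv j
    rw [← Function.update_eq_self i v, ← huw, g.map_update_add, g.map_update_smul]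
    refine add_mem (ih _ (hmem u (Submodule.mem_sup_left hu)) fun j hj => ?_)
      (T.smul_mem c (hx _ i (hmem x ?_) (by simp)))
    · rcases eq_or_ne j i with rfl | hji
      · simpa using hu
      · simpa [hji] using h j (by simp [hji, hj])
    · exact Submodule.mem_sup_right (Submodule.mem_span_singleton_self x)

theorem bracket_mem_of_forall_mem_sup_span {f : L [⋀^Fin (m + 1)]→ₗ[F] L} {M : Submodule F L}
    (hM : ∀ a : Fin (m + 1) → L, (∀ i, a i ∈ M) → f a ∈ M) {x : L}
    (hx : ∀ a : Fin m → L, (∀ i, a i ∈ M) → inner f a x ∈ M)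
    (v : Fin (m + 1) → L) (hv : ∀ i, v i ∈ M ⊔ F ∙ x) : f v ∈ M := by
  refine mem_of_forall_mem_sup_span f hM (fun v i hv hi => ?_) v hv
  refine mem_of_comp_perm_mem f (Equiv.swap i (Fin.last m)) ?_
  set w := v ∘ Equiv.swap i (Fin.last m) with hw
  have hwl : w (Fin.last m) = x := by simp [hw, hi]
  rw [← Fin.snoc_init_self w, hwl, ← inner_apply]
  refine mem_of_forall_mem_sup_span
    ((LinearMap.applyₗ x).compAlternatingMap (inner f)) (T := M) hx (fun a j _ hj => ?_)
    (Fin.init w) fun j => hv _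
  convert M.zero_mem
  exact f.map_eq_zero_of_eq (i := j.castSucc) (j := Fin.last _) _ (by simpa using hj)
    (Fin.castSucc_lt_last j).ne

theorem innerSpan_sup_span_le (f : L [⋀^Fin (m + 2)]→ₗ[F] L) (M : Submodule F L) (x : L) :
    innerSpan f (M ⊔ F ∙ x) ≤ innerSpan f M ⊔ innerSpan (f.curryLeft x) ⊤ := by
  refine Submodule.span_le.2 ?_
  rintro _ ⟨v, hv, rfl⟩
  refine mem_of_forall_mem_sup_span (inner f)
    (fun v hv => Submodule.mem_sup_left (inner_mem_innerSpan f hv)) (fun v i hv hi => ?_) v hv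
  refine mem_of_comp_perm_mem (inner f) (Equiv.swap i 0) ?_
  set w := v ∘ Equiv.swap i 0 with hw
  have hw0 : w 0 = x := by simp [hw, hi]
  rw [← Fin.cons_self_tail w, hw0, ← inner_curryLeft]
  exact Submodule.mem_sup_right (inner_mem_innerSpan _ fun _ => Submodule.mem_top)

/-- If all inner derivations are nilpotent, then so are their linear combinations. The induction is
on the arity, through the brackets `[x, …]` with a fixed first entry `x`. -/
theorem isNilpotent_of_mem_innerSpan [FiniteDimensional F L] (m : ℕ) :
    ∀ f : L [⋀^Fin (m + 1)]→ₗ[F] L, IsJacobi f → (∀ a, IsNilpotent (inner f a)) →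
      ∀ d ∈ innerSpan f ⊤, IsNilpotent d := by
  induction m with
  | zero =>
    intro f _ h d hd
    have hsub : inner f '' {a | ∀ i, a i ∈ (⊤ : Submodule F L)} ⊆ {inner f 0} := by
      rintro _ ⟨a, -, rfl⟩
      rw [Subsingleton.elim a 0]
      rfl
    obtain ⟨c, rfl⟩ := Submodule.mem_span_singleton.1 (Submodule.span_mono hsub hd)
    exact (h 0).smul c
  | succ m ih =>
    intro f hf h
    obtain ⟨M, ⟨hM, hMn⟩, hmax⟩ := (wellFounded_gt (α := Submodule F L)).has_min
      {M | (∀ a : Fin (m + 2) → L, (∀ i, a i ∈ M) → f a ∈ M) ∧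
        ∀ d ∈ innerSpan f M, IsNilpotent d}
      ⟨⊥, fun a ha => by simpa using f.map_coord_zero 0 (ha 0), fun d hd => by
        have hsub : inner f '' {a | ∀ i, a i ∈ (⊥ : Submodule F L)} ⊆ {0} := by
          rintro _ ⟨a, ha, rfl⟩
          exact (inner f).map_coord_zero 0 (ha 0)
        have : d = 0 := by simpa using Submodule.span_mono hsub hd
        exact this ▸ IsNilpotent.zero⟩
    suffices M = ⊤ from this ▸ hMn
    by_contra hne
    obtain ⟨x, hxM, hx⟩ := exists_notMem_forall_apply_mem (A := innerLie hf hM) hMn hne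
    have hM' : ∀ a : Fin (m + 2) → L, (∀ i, a i ∈ M ⊔ F ∙ x) → f a ∈ M ⊔ F ∙ x := fun a ha =>
      Submodule.mem_sup_left <| bracket_mem_of_forall_mem_sup_span hM
        (fun b hb => hx _ (inner_mem_innerSpan f hb)) a ha
    refine hmax (M ⊔ F ∙ x) ⟨hM', fun d hd => ?_⟩ (left_lt_sup.2 fun hle =>
      hxM (hle (Submodule.mem_span_singleton_self x)))
    refine isNilpotent_of_forall_exists_sub_mem (G := innerLie hf hM')
      (A := (innerLie hf hM).comap (innerLie hf hM').incl) (fun y hy => hMn _ hy)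
      (fun g => ?_) ⟨d, hd⟩
    obtain ⟨a, ha, b, hb, hab⟩ := Submodule.mem_sup.1 (innerSpan_sup_span_le f M x g.2)
    have hbG : b ∈ innerLie hf hM' := by
      rw [eq_sub_of_add_eq' hab]
      exact sub_mem g.2 (innerSpan_mono f le_sup_left ha)
    refine ⟨⟨b, hbG⟩, ih _ (hf.curryLeft x) (fun v => ?_) b hb, ?_⟩
    · rw [inner_curryLeft]
      exact h _
    · change (g : Module.End F L) - b ∈ innerSpan f M
      rwa [← hab, add_sub_cancel_right]

end Inner

/-- If every inner derivation `D(x₁,…,x_{n-1})` of `L` is nilpotent as a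
linear map, then `L` is nilpotent (Kasymov's Engel theorem). -/
theorem stmt8 {F : Type*} [Field F] {L : Type*} [AddCommGroup L] [Module F L]
    [FiniteDimensional F L] {n : ℕ} (f : AlternatingMap F L L (Fin (n + 2)))
    (hf : IsNLie f)
    (h : ∀ a : Fin (n + 1) → L, ∃ r, (D f a) ^ r = 0) :
    IsNilpotentAlg f := by
  have hf' : IsJacobi f := hf
  have hM : ∀ a : Fin (n + 2) → L, (∀ i, a i ∈ (⊤ : Submodule F L)) → f a ∈ (⊤ : Submodule F L) :=
    fun _ _ => Submodule.mem_top
  have hnil : LieModule.IsNilpotent (innerLie hf' hM) L :=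
    LieAlgebra.isEngelian_of_isNoetherian (R := F) _ fun y =>
      isNilpotent_of_mem_innerSpan (n + 1) f hf' h _ y.2
  obtain ⟨k, hk⟩ := LieModule.IsNilpotent.nilpotent F (innerLie hf' hM) L
  suffices ∀ s, lcsIn f ⊤ s ≤
      (LieModule.lowerCentralSeries F (innerLie hf' hM) L s : Submodule F L) from
    ⟨k, by simpa [hk] using this k⟩
  intro s
  induction s with
  | zero => simp
  | succ s ih =>
    refine Submodule.span_le.2 ?_
    rintro _ ⟨a, ha, rfl⟩
    refine mem_of_comp_perm_mem f (Equiv.swap 0 (Fin.last _)) ?_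
    set w := a ∘ Equiv.swap 0 (Fin.last (n + 1)) with hw
    have hwl : w (Fin.last _) = a 0 := by simp [hw]
    rw [← Fin.snoc_init_self w, hwl, ← inner_apply, LieModule.lowerCentralSeries_succ]
    exact LieSubmodule.lie_mem_lie (LieSubmodule.mem_top
      (⟨inner f (Fin.init w), inner_mem_innerSpan f fun _ => Submodule.mem_top⟩ :
        innerLie hf' hM)) (ih (ha 0))

end NLie
end

section
/- Let L be a finite-dimensional n-Lie algebra, let A be a minimal abelian embedded ideal of L, and let B be an ideal of L containing A such that B/A is an abelian embedded ideal of L/A. Suppose that for every b ∈ B and all x1,…,x_{n-2} ∈ L the restriction of D(b,x1,…,x_{n-2}) to A is nilpotent. Then [A,B,(n-2)L] = 0. -/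
namespace NLie

open Finset

variable {F : Type*} [Field F] {L : Type*} [AddCommGroup L] [Module F L] {n : ℕ}

theorem mem_of_apply_mem {f : AlternatingMap F L L (Fin (n + 2))} {K M : Submodule F L}
    (h : ∀ z : Fin (n + 2) → L, z 0 ∈ K → f z ∈ M) {z : Fin (n + 2) → L} (i : Fin (n + 2))
    (hi : z i ∈ K) : f z ∈ M := by
  have hz := h (z ∘ Equiv.swap 0 i) (by simpa using hi)
  rw [f.map_perm] at hz
  rcases Int.units_eq_one_or (Equiv.Perm.sign (Equiv.swap 0 i)) with hs | hs <;>
    simpa [hs] using hz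

theorem mem_of_apply_mem_pair {f : AlternatingMap F L L (Fin (n + 2))} {K M : Submodule F L}
    (h : ∀ z : Fin (n + 2) → L, z 0 ∈ K → z 1 ∈ K → f z ∈ M) {z : Fin (n + 2) → L}
    {i j : Fin (n + 2)} (hij : i ≠ j) (hi : z i ∈ K) (hj : z j ∈ K) : f z ∈ M := by
  obtain ⟨σ, h0, h1⟩ : ∃ σ : Equiv.Perm (Fin (n + 2)), σ 0 = i ∧ σ 1 = j := by
    refine ⟨Equiv.swap (Equiv.swap 0 i 1) j * Equiv.swap 0 i, ?_, by simp⟩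
    rw [Equiv.Perm.mul_apply, Equiv.swap_apply_left, Equiv.swap_apply_of_ne_of_ne _ hij]
    intro h
    have := (Equiv.swap (0 : Fin (n + 2)) i).injective ((Equiv.swap_apply_left 0 i).trans h)
    simp at this
  have hz := h (z ∘ σ) (by simpa [h0] using hi) (by simpa [h1] using hj)
  rw [f.map_perm] at hz
  rcases Int.units_eq_one_or (Equiv.Perm.sign σ) with hs | hs <;> simpa [hs] using hz

theorem D_apply (f : AlternatingMap F L L (Fin (n + 2))) (u : Fin (n + 1) → L) (x : L) :
    D f u x = f (Fin.snoc u x) := rfl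

theorem IsNLie.D_D {f : AlternatingMap F L L (Fin (n + 2))} (hf : IsNLie f)
    (u v : Fin (n + 1) → L) (x : L) :
    D f u (D f v x) =
      ∑ i, D f (Function.update v i (D f u (v i))) x + D f v (D f u x) := by
  have h := hf u (Fin.snoc v x)
  rw [Fin.sum_univ_castSucc] at h
  simpa only [D_apply, Fin.snoc_castSucc, Fin.snoc_last, Fin.update_snoc_last,
    Fin.snoc_update] using h

theorem D_mem_of_mem {f : AlternatingMap F L L (Fin (n + 2))} {K : Submodule F L}
    (hK : IsIdeal f K) (u : Fin (n + 1) → L) {x : L} (hx : x ∈ K) : D f u x ∈ K :=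
  mem_of_apply_mem hK (Fin.last _) (by simpa using hx)

theorem D_mem_of_apply_mem {f : AlternatingMap F L L (Fin (n + 2))} {K : Submodule F L}
    (hK : IsIdeal f K) {u : Fin (n + 1) → L} (i : Fin (n + 1)) (hi : u i ∈ K) (x : L) :
    D f u x ∈ K :=
  mem_of_apply_mem hK i.castSucc (by simpa using hi)

theorem D_mem_of_mem_of_mem {f : AlternatingMap F L L (Fin (n + 2))} {K M : Submodule F L}
    (h : ∀ z : Fin (n + 2) → L, z 0 ∈ K → z 1 ∈ K → f z ∈ M) {u : Fin (n + 1) → L}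
    (i : Fin (n + 1)) (hi : u i ∈ K) {x : L} (hx : x ∈ K) : D f u x ∈ M :=
  mem_of_apply_mem_pair h (Fin.castSucc_lt_last i).ne (by simpa using hi) (by simpa using hx)

/-- A subspace stable under all inner derivations is an ideal. -/
theorem isIdeal_of_forall_D_mem {f : AlternatingMap F L L (Fin (n + 2))} {K : Submodule F L}
    (h : ∀ u, ∀ x ∈ K, D f u x ∈ K) : IsIdeal f K := by
  have key : ∀ z : Fin (n + 2) → L, z (Fin.last _) ∈ K → f z ∈ K := fun z hz => by
    simpa [D_apply, Fin.snoc_init_self] using h (Fin.init z) _ hz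
  intro z hz
  have hs := key (z ∘ Equiv.swap 0 (Fin.last _)) (by simpa using hz)
  rw [f.map_perm] at hs
  rcases Int.units_eq_one_or (Equiv.Perm.sign (Equiv.swap 0 (Fin.last (n + 1)))) with h | h <;>
    simpa [h] using hs

/-- At least `k` entries of the tuple `u` lie in `B`. -/
def HasEntriesIn (B : Submodule F L) (k : ℕ) (u : Fin (n + 1) → L) : Prop :=
  ∃ S : Finset (Fin (n + 1)), k ≤ S.card ∧ ∀ i ∈ S, u i ∈ B

theorem HasEntriesIn.update {B : Submodule F L} {k : ℕ} {u : Fin (n + 1) → L}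
    (hu : HasEntriesIn B k u) (i : Fin (n + 1)) {w : L} (hw : u i ∈ B → w ∈ B) :
    HasEntriesIn B k (Function.update u i w) := by
  obtain ⟨S, hS, hSB⟩ := hu
  refine ⟨S, hS, fun j hj => ?_⟩
  rcases eq_or_ne j i with rfl | hji
  · simpa using hw (hSB j hj)
  · simpa [hji] using hSB j hj

/-- The elements of `A` annihilated by every `D(u)` where `u` has at least `k` entries in `B`. -/
def annihilated (f : AlternatingMap F L L (Fin (n + 2))) (A B : Submodule F L) (k : ℕ) :
    Submodule F L :=
  A ⊓ ⨅ u : {u : Fin (n + 1) → L // HasEntriesIn B k u}, LinearMap.ker (D f u.1)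

theorem mem_annihilated {f : AlternatingMap F L L (Fin (n + 2))} {A B : Submodule F L} {k : ℕ}
    {x : L} : x ∈ annihilated f A B k ↔ x ∈ A ∧ ∀ u, HasEntriesIn B k u → D f u x = 0 := by
  simp [annihilated, Submodule.mem_iInf]

theorem isIdeal_annihilated {f : AlternatingMap F L L (Fin (n + 2))} (hf : IsNLie f)
    {A B : Submodule F L} (hA : IsIdeal f A) (hB : IsIdeal f B) (k : ℕ) :
    IsIdeal f (annihilated f A B k) := by
  refine isIdeal_of_forall_D_mem fun u x hx => ?_
  rw [mem_annihilated] at hx ⊢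
  refine ⟨D_mem_of_mem hA u hx.1, fun v hv => ?_⟩
  have h := hf.D_D u v x
  rw [hx.2 v hv, map_zero, Finset.sum_eq_zero, zero_add] at h
  · exact h.symm
  · exact fun i _ => hx.2 _ (hv.update i (D_mem_of_mem hB u))

/-- A family of endomorphisms which commute and are nilpotent on a nonzero invariant
subspace has a nonzero common kernel there. -/
theorem exists_ne_zero_forall_apply_eq_zero [FiniteDimensional F L] {A : Submodule F L}
    (hA : A ≠ ⊥) (T : Set (L →ₗ[F] L)) (hTA : ∀ t ∈ T, ∀ x ∈ A, t x ∈ A)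
    (hcomm : ∀ s ∈ T, ∀ t ∈ T, ∀ x ∈ A, s (t x) = t (s x))
    (hnil : ∀ t ∈ T, ∃ r, ∀ x ∈ A, (t ^ r) x = 0) :
    ∃ x ∈ A, x ≠ 0 ∧ ∀ t ∈ T, t x = 0 := by
  obtain ⟨W, ⟨hW0, hWA, hWT⟩, hmin⟩ := WellFounded.has_min
    (wellFounded_lt : WellFounded ((· < ·) : Submodule F L → Submodule F L → Prop))
    {W | W ≠ ⊥ ∧ W ≤ A ∧ ∀ t ∈ T, ∀ x ∈ W, t x ∈ W} ⟨A, hA, le_rfl, hTA⟩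
  obtain ⟨w, hw, hw0⟩ := W.ne_bot_iff.1 hW0
  refine ⟨w, hWA hw, hw0, fun t ht => ?_⟩
  have hpow : ∀ r, (t ^ r) w ∈ W := fun r => by
    induction r with
    | zero => simpa using hw
    | succ r ih => simpa [pow_succ'] using hWT t ht _ ih
  have hker : W ⊓ LinearMap.ker t ≠ ⊥ := by
    classical
    obtain ⟨r, hr⟩ := hnil t ht
    have hex : ∃ r, (t ^ r) w = 0 := ⟨r, hr w (hWA hw)⟩
    obtain ⟨m, hm⟩ : ∃ m, Nat.find hex = m + 1 := Nat.exists_eq_succ_of_ne_zero fun h0 =>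
      hw0 (by simpa [h0] using Nat.find_spec hex)
    refine (Submodule.ne_bot_iff _).2 ⟨(t ^ m) w, ⟨hpow m, ?_⟩, Nat.find_min hex (by omega)⟩
    have h := Nat.find_spec hex
    rw [hm, pow_succ'] at h
    simpa using h
  have heq : W ⊓ LinearMap.ker t = W := by
    by_contra hne
    refine hmin (W ⊓ LinearMap.ker t) ⟨hker, inf_le_left.trans hWA, ?_⟩
      (lt_of_le_of_ne inf_le_left hne)
    rintro s hs x ⟨hxW, hxt⟩
    refine ⟨hWT s hs x hxW, ?_⟩
    rw [SetLike.mem_coe, LinearMap.mem_ker] at hxt ⊢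
    rw [hcomm t ht s hs x (hWA hxW), hxt, map_zero]
  exact LinearMap.mem_ker.1 (inf_eq_left.1 heq hw)

theorem exists_pow_D_eq_zero {f : AlternatingMap F L L (Fin (n + 2))} {A B : Submodule F L}
    (hnil : ∀ b ∈ B, ∀ x : Fin n → L, ∃ r, ∀ a ∈ A, ((D f (Fin.cons b x)) ^ r) a = 0)
    {u : Fin (n + 1) → L} (i : Fin (n + 1)) (hi : u i ∈ B) :
    ∃ r, ∀ a ∈ A, (D f u ^ r) a = 0 := by
  obtain ⟨r, hr⟩ := hnil (u i) hi (Fin.tail (u ∘ Equiv.swap 0 i))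
  have hcons : (Fin.cons (u i) (Fin.tail (u ∘ Equiv.swap 0 i)) : Fin (n + 1) → L)
      = u ∘ Equiv.swap 0 i := by
    rw [← Fin.cons_self_tail (u ∘ Equiv.swap 0 i)]
    simp
  rw [hcons] at hr
  refine ⟨r, fun a ha => ?_⟩
  rcases eq_or_ne i 0 with rfl | hi0
  · simpa using hr a ha
  have hneg : D f (u ∘ Equiv.swap 0 i) = -D f u := by
    ext x
    have hsw : (Fin.snoc (u ∘ Equiv.swap 0 i) x : Fin (n + 2) → L)
        = (Fin.snoc u x : Fin (n + 2) → L) ∘ Equiv.swap (0 : Fin (n + 1)).castSucc i.castSucc := by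
      funext j
      refine Fin.lastCases ?_ (fun j => ?_) j
      · rw [Function.comp_apply, Equiv.swap_apply_of_ne_of_ne
          (Fin.castSucc_lt_last _).ne' (Fin.castSucc_lt_last _).ne']
        simp
      · rw [Function.comp_apply, ← (Fin.castSucc_injective (n + 1)).map_swap]
        simp
    rw [LinearMap.neg_apply, D_apply, D_apply, hsw]
    exact f.map_swap _ fun h => hi0 (Fin.castSucc_injective _ h).symm
  have h := hr a ha
  rw [hneg, neg_pow] at h
  rcases neg_one_pow_eq_or (L →ₗ[F] L) r with hs | hs <;> simpa [hs] using h

theorem le_annihilated_of_succ [FiniteDimensional F L]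
    {f : AlternatingMap F L L (Fin (n + 2))} (hf : IsNLie f) {A B : Submodule F L}
    (hA : IsMinAbelianEmbeddedIdeal f A) (hB : IsIdeal f B)
    (hBmodA : ∀ z : Fin (n + 2) → L, z 0 ∈ B → z 1 ∈ B → f z ∈ A)
    (hnil : ∀ b ∈ B, ∀ x : Fin n → L, ∃ r, ∀ a ∈ A, ((D f (Fin.cons b x)) ^ r) a = 0)
    {k : ℕ} (hk : 1 ≤ k) (h : A ≤ annihilated f A B (k + 1)) : A ≤ annihilated f A B k := by
  obtain ⟨hA0, hAi, hAab, hAmin⟩ := hA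
  have hentry : ∀ u : Fin (n + 1) → L, HasEntriesIn B k u → ∃ i, u i ∈ B := by
    rintro u ⟨S, hS, hSB⟩
    obtain ⟨i, hi⟩ := Finset.card_pos.1 (hk.trans hS)
    exact ⟨i, hSB i hi⟩
  have hcomm : ∀ u v : Fin (n + 1) → L, HasEntriesIn B k u → HasEntriesIn B k v →
      ∀ x ∈ A, D f u (D f v x) = D f v (D f u x) := by
    intro u v hu hv x hx
    rw [hf.D_D u v x, Finset.sum_eq_zero, zero_add]
    intro i _
    obtain ⟨j, hj⟩ := hentry u hu
    obtain ⟨S, hS, hSB⟩ := hv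
    by_cases hi : i ∈ S
    · have hmem : D f u (v i) ∈ A := D_mem_of_mem_of_mem hBmodA j hj (hSB i hi)
      refine (Submodule.mem_bot F).1 (D_mem_of_mem_of_mem (K := A) ?_ i (by simpa using hmem) hx)
      exact fun z h0 h1 => (Submodule.mem_bot F).2 (hAab z h0 h1)
    · refine (mem_annihilated.1 (h hx)).2 _ ⟨insert i S, ?_, fun l hl => ?_⟩
      · rw [Finset.card_insert_of_notMem hi]
        omega
      · rcases eq_or_ne l i with rfl | hli
        · simpa using D_mem_of_apply_mem hB j hj (v l)
        · simpa [hli] using hSB l (Finset.mem_of_mem_insert_of_ne hl hli)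
  obtain ⟨x, hxA, hx0, hx⟩ := exists_ne_zero_forall_apply_eq_zero hA0
    {t | ∃ u, HasEntriesIn B k u ∧ D f u = t}
    (by rintro _ ⟨u, -, rfl⟩ x hx; exact D_mem_of_mem hAi u hx)
    (by rintro _ ⟨u, hu, rfl⟩ _ ⟨v, hv, rfl⟩ x hx; exact hcomm u v hu hv x hx)
    (by
      rintro _ ⟨u, hu, rfl⟩
      obtain ⟨i, hi⟩ := hentry u hu
      exact exists_pow_D_eq_zero hnil i hi)
  by_contra hne
  have hbot := hAmin _ (isIdeal_annihilated hf hAi hB k)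
    (lt_of_le_not_ge (inf_le_left : annihilated f A B k ≤ A) hne)
  have hxmem : x ∈ annihilated f A B k :=
    mem_annihilated.2 ⟨hxA, fun u hu => hx _ ⟨u, hu, rfl⟩⟩
  rw [hbot] at hxmem
  exact hx0 ((Submodule.mem_bot F).1 hxmem)

/-- Let `A` be a minimal abelian embedded ideal of `L`, and `B ⊇ A` an
ideal of `L` such that `B/A` is an abelian embedded ideal of `L/A`.  If the restriction to
`A` of every `D(b,x₁,…,x_{n-2})` with `b ∈ B` is nilpotent, then `[A,B,(n-2)L] = 0`. -/
theorem stmt10 {F : Type*} [Field F] {L : Type*} [AddCommGroup L] [Module F L]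
    [FiniteDimensional F L] {n : ℕ} (f : AlternatingMap F L L (Fin (n + 2)))
    (hf : IsNLie f) (A B : Submodule F L)
    (hA : IsMinAbelianEmbeddedIdeal f A) (hB : IsIdeal f B) (hAB : A ≤ B)
    (hBmodA : ∀ z : Fin (n + 2) → L, z 0 ∈ B → z 1 ∈ B → f z ∈ A)
    (hnil : ∀ b ∈ B, ∀ x : Fin n → L,
      ∃ r, ∀ a ∈ A, ((D f (Fin.cons b x)) ^ r) a = 0) :
    bracketSpan f (Fin.cons A (Fin.cons B fun _ => ⊤)) = ⊥ := by
  have hle : ∀ m, m ≤ n + 1 → A ≤ annihilated f A B (n + 2 - m) := by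
    intro m
    induction m with
    | zero =>
      refine fun _ x hx => mem_annihilated.2 ⟨hx, ?_⟩
      rintro u ⟨S, hS, -⟩
      have := S.card_le_univ
      simp only [Fintype.card_fin] at this
      omega
    | succ m ih =>
      intro hm
      refine le_annihilated_of_succ hf hA hB hBmodA hnil (by omega) ?_
      rw [show n + 2 - (m + 1) + 1 = n + 2 - m by omega]
      exact ih (by omega)
  have hone := hle (n + 1) le_rfl
  rw [show n + 2 - (n + 1) = 1 by omega] at hone
  refine Submodule.span_eq_bot.2 ?_
  rintro _ ⟨a, ha, rfl⟩
  have h0 : a 0 ∈ A := ha 0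
  have h1 : a 1 ∈ B := ha 1
  have hz : D f (Fin.init (a ∘ Equiv.swap 0 (Fin.last (n + 1)))) (a 0) = 0 := by
    refine (mem_annihilated.1 (hone h0)).2 _ ?_
    rcases n.eq_zero_or_pos with rfl | hn
    · exact ⟨{0}, by simp, by simpa [Fin.init] using h1⟩
    · refine ⟨{⟨1, by omega⟩}, by simp, fun i hi => ?_⟩
      rw [Finset.mem_singleton] at hi
      subst hi
      have hs : Equiv.swap 0 (Fin.last (n + 1)) (1 : Fin (n + 2)) = 1 :=
        Equiv.swap_apply_of_ne_of_ne (by simp) (by simp [Fin.ext_iff]; omega)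
      have hc : (⟨1, by omega⟩ : Fin (n + 1)).castSucc = 1 := by simp
      simpa [Fin.init, hc, hs] using h1
  have hsnoc : (Fin.snoc (Fin.init (a ∘ Equiv.swap 0 (Fin.last (n + 1)))) (a 0) :
      Fin (n + 2) → L) = a ∘ Equiv.swap 0 (Fin.last (n + 1)) := by
    rw [← Fin.snoc_init_self (a ∘ Equiv.swap 0 (Fin.last (n + 1)))]
    simp
  rw [D_apply, hsnoc, f.map_swap a (by simp [Fin.ext_iff])] at hz
  exact neg_eq_zero.1 hz

end NLie
end
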